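/- arXiv:1608.03174 — 3 statements merged into one kernel-verified Lean document; each statement's English description precedes it below -/
import Mathlib

section
/- For all positive integers n and r, ζ(2n+1)/r^{2n} = (-1)^{n+1} ∫_{(0,1)^n} (∏_{i=1}^{n} log(x_i)/x_i) · log(1 - (∏_{i=1}^{n} x_i)^r) dx_1 ⋯ dx_n. -/
open MeasureTheory Real

/-- The Riemann zeta function at integer arguments `s ≥ 2`, as the convergent
series `∑_{k=1}^∞ 1/k^s`. -/
noncomputable def zetaVal (s : ℕ) : ℝ := ∑' k : ℕ, 1 / ((k : ℝ) + 1) ^ s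

theorem intervalIntegrable_log_mul_pow (p : ℕ) (a b : ℝ) :
    IntervalIntegrable (fun x : ℝ => log x * x ^ p) volume a b :=
  intervalIntegral.intervalIntegrable_log'.mul_continuousOn (continuous_pow p).continuousOn

theorem integrableOn_log_mul_pow (p : ℕ) :
    IntegrableOn (fun x : ℝ => log x * x ^ p) (Set.Ioo 0 1) :=
  (intervalIntegrable_iff_integrableOn_Ioo_of_le zero_le_one).1
    (intervalIntegrable_log_mul_pow p 0 1)

theorem setIntegral_log_mul_pow (p : ℕ) :
    ∫ x in Set.Ioo (0 : ℝ) 1, log x * x ^ p = -(1 / ((p : ℝ) + 1) ^ 2) := by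
  have hp : (p : ℝ) + 1 ≠ 0 := by positivity
  rw [← integral_Ioc_eq_integral_Ioo, ← intervalIntegral.integral_of_le zero_le_one,
    intervalIntegral.integral_eq_sub_of_hasDerivAt_of_le (f := fun x : ℝ =>
      x ^ p * (x * log x) / (p + 1) - x ^ (p + 1) / ((p : ℝ) + 1) ^ 2) zero_le_one ?_ ?_
      (intervalIntegrable_log_mul_pow p 0 1)]
  · simp
  · exact ((((continuous_pow p).mul continuous_mul_log).div_const _).sub
      ((continuous_pow (p + 1)).div_const _)).continuousOn
  · intro x hx
    have hx0 : x ≠ 0 := hx.1.ne'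
    have h1 : HasDerivAt (fun x : ℝ => x ^ (p + 1) * log x)
        ((p + 1 : ℕ) * x ^ p * log x + x ^ (p + 1) * x⁻¹) x :=
      (hasDerivAt_pow (p + 1) x).mul (hasDerivAt_log hx0)
    have h2 := (h1.div_const ((p : ℝ) + 1)).sub
      ((hasDerivAt_pow (p + 1) x).div_const (((p : ℝ) + 1) ^ 2))
    refine (h2.congr_deriv ?_).congr_of_eventuallyEq (Filter.Eventually.of_forall fun y => ?_)
    · push_cast
      field_simp
      ring
    · simp [pow_succ, mul_assoc]

theorem setIntegral_norm_log_mul_pow (p : ℕ) :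
    ∫ x in Set.Ioo (0 : ℝ) 1, ‖log x * x ^ p‖ = 1 / ((p : ℝ) + 1) ^ 2 := by
  rw [← neg_neg (1 / ((p : ℝ) + 1) ^ 2), ← setIntegral_log_mul_pow, ← integral_neg]
  refine setIntegral_congr_fun measurableSet_Ioo fun x hx => ?_
  exact norm_of_nonpos
    (mul_nonpos_of_nonpos_of_nonneg (log_nonpos hx.1.le hx.2.le) (pow_nonneg hx.1.le p))

theorem hasSum_prod_log_div_mul_log_one_sub {ι : Type*} [Fintype ι] [Nonempty ι]
    (r : ℕ) (hr : 0 < r) (x : ι → ℝ) (hx : ∀ i, x i ∈ Set.Ioo (0 : ℝ) 1) :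
    HasSum (fun k : ℕ => -(1 / ((k : ℝ) + 1)) * ∏ i, (log (x i) * x i ^ (r * (k + 1) - 1)))
      ((∏ i, log (x i) / x i) * log (1 - (∏ i, x i) ^ r)) := by
  have h0 : 0 < ∏ i, x i := Finset.prod_pos fun i _ => (hx i).1
  have h1 : ∏ i, x i < 1 := by
    simpa using Finset.prod_lt_prod_of_nonempty (s := Finset.univ) (f := x) (g := fun _ => 1)
      (fun i _ => (hx i).1) (fun i _ => (hx i).2) Finset.univ_nonempty
  have hu : |(∏ i, x i) ^ r| < 1 := by
    rw [abs_of_pos (pow_pos h0 r)]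
    exact pow_lt_one₀ h0.le h1 hr.ne'
  have hs := (hasSum_pow_div_log_of_abs_lt_one hu).neg.mul_left (∏ i, log (x i) / x i)
  rw [neg_neg] at hs
  refine hs.congr_fun fun k => ?_
  obtain ⟨p, hp⟩ : ∃ p, r * (k + 1) = p + 1 :=
    Nat.exists_eq_succ_of_ne_zero (by positivity)
  rw [← pow_mul, hp, Nat.add_sub_cancel, Finset.prod_mul_distrib, Finset.prod_div_distrib,
    Finset.prod_pow]
  have := h0.ne'
  field_simp
  ring

theorem zeta_odd_integral_pow (n r : ℕ) (hn : 0 < n) (hr : 0 < r) :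
    zetaVal (2 * n + 1) / (r : ℝ) ^ (2 * n) =
      (-1 : ℝ) ^ (n + 1) *
        ∫ x in Set.univ.pi (fun _ : Fin n => Set.Ioo (0 : ℝ) 1),
          (∏ i, Real.log (x i) / x i) * Real.log (1 - (∏ i, x i) ^ r) := by
  have : NeZero n := ⟨hn.ne'⟩
  have hr0 : (r : ℝ) ≠ 0 := by positivity
  have hμ : (volume : Measure (Fin n → ℝ)).restrict (Set.univ.pi fun _ => Set.Ioo (0 : ℝ) 1) =
      Measure.pi fun _ => (volume : Measure ℝ).restrict (Set.Ioo 0 1) := by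
    rw [volume_pi, Measure.restrict_pi_pi]
  let F : ℕ → (Fin n → ℝ) → ℝ := fun k x =>
    -(1 / ((k : ℝ) + 1)) * ∏ i, (log (x i) * x i ^ (r * (k + 1) - 1))
  have hcast (k : ℕ) : (((r * (k + 1) - 1 : ℕ) : ℝ) + 1) = r * (k + 1) := by
    rw [Nat.cast_sub (Nat.succ_le_of_lt (by positivity))]
    push_cast
    ring
  have hF_int (k : ℕ) : Integrable (F k)
      (volume.restrict (Set.univ.pi fun _ => Set.Ioo (0 : ℝ) 1)) := by
    rw [hμ]
    exact (Integrable.fintype_prod fun _ => integrableOn_log_mul_pow _).const_mul _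
  have hF (k : ℕ) : ∫ x in Set.univ.pi (fun _ : Fin n => Set.Ioo (0 : ℝ) 1), F k x =
      (-1) ^ (n + 1) * (1 / ((k : ℝ) + 1) ^ (2 * n + 1) / (r : ℝ) ^ (2 * n)) := by
    rw [hμ, integral_const_mul,
      integral_fintype_prod_eq_prod (fun _ x => log x * x ^ (r * (k + 1) - 1))]
    simp only [setIntegral_log_mul_pow, hcast, Finset.prod_const, Finset.card_univ,
      Fintype.card_fin]
    rw [neg_pow, one_div_pow, ← pow_mul, mul_pow]
    field_simp
    ring
  have hF_norm (k : ℕ) : ∫ x in Set.univ.pi (fun _ : Fin n => Set.Ioo (0 : ℝ) 1), ‖F k x‖ =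
      1 / ((k : ℝ) + 1) ^ (2 * n + 1) / (r : ℝ) ^ (2 * n) := by
    have hk : ‖-(1 / ((k : ℝ) + 1))‖ = 1 / ((k : ℝ) + 1) := by
      rw [norm_neg, norm_of_nonneg (by positivity)]
    simp only [F, norm_mul _ (Finset.prod _ _), hk, norm_prod]
    rw [hμ, integral_const_mul,
      integral_fintype_prod_eq_prod (fun _ x => ‖log x * x ^ (r * (k + 1) - 1)‖)]
    simp only [setIntegral_norm_log_mul_pow, hcast, Finset.prod_const, Finset.card_univ,
      Fintype.card_fin]
    rw [one_div_pow, ← pow_mul, mul_pow]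
    field_simp
    ring
  have hsummable : Summable fun k : ℕ => 1 / ((k : ℝ) + 1) ^ (2 * n + 1) := by
    simpa using (summable_nat_add_iff 1).2
      (Real.summable_one_div_nat_pow.2 (show 1 < 2 * n + 1 by omega))
  have hsum := hasSum_integral_of_summable_integral_norm hF_int
    (by simpa only [hF_norm] using hsummable.div_const _)
  have htsum : ∫ x in Set.univ.pi (fun _ : Fin n => Set.Ioo (0 : ℝ) 1), ∑' k, F k x =
      ∫ x in Set.univ.pi (fun _ : Fin n => Set.Ioo (0 : ℝ) 1),
        (∏ i, log (x i) / x i) * log (1 - (∏ i, x i) ^ r) :=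
    setIntegral_congr_fun (MeasurableSet.univ_pi fun _ => measurableSet_Ioo) fun x hx =>
      (hasSum_prod_log_div_mul_log_one_sub r hr x fun i => hx i trivial).tsum_eq
  simp only [hF] at hsum
  rw [← htsum, ← hsum.tsum_eq, tsum_mul_left, tsum_div_const, ← mul_assoc, ← mul_pow, zetaVal]
  simp
end

section
/- For every integer k ≥ 1, ∫_{(0,1)^2} (log(x)/x)·(log(y)/y)·log(1-(xy)^2)·log(x)·log(y)·(xy)^{2k+1} dx dy = −4 ∑_{u=1}^{∞} 1/(u·(2k+1+2u)^6). -/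
open MeasureTheory Real

/-- The antiderivative of `x ^ (n + 1) * log x ^ 2` vanishing at `0` is continuous on `ℝ`. -/
lemma continuous_pow_mul_log_sq_primitive (n : ℕ) :
    Continuous fun x : ℝ => x ^ n * (x * log x) ^ 2 / (n + 2) -
      2 * (x ^ (n + 1) * (x * log x)) / (n + 2) ^ 2 + 2 * x ^ (n + 2) / (n + 2) ^ 3 := by
  have := Real.continuous_mul_log
  fun_prop

lemma hasDerivAt_pow_mul_log_sq_primitive (n : ℕ) {x : ℝ} (hx : x ≠ 0) :
    HasDerivAt (fun x : ℝ => x ^ n * (x * log x) ^ 2 / (n + 2) -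
      2 * (x ^ (n + 1) * (x * log x)) / (n + 2) ^ 2 + 2 * x ^ (n + 2) / (n + 2) ^ 3)
      (x ^ (n + 1) * log x ^ 2) x := by
  have hfun : (fun x : ℝ => x ^ n * (x * log x) ^ 2 / (n + 2) -
      2 * (x ^ (n + 1) * (x * log x)) / (n + 2) ^ 2 + 2 * x ^ (n + 2) / (n + 2) ^ 3) =
      fun x : ℝ => x ^ (n + 2) * (log x ^ 2 / (n + 2) - 2 * log x / (n + 2) ^ 2
        + 2 / (n + 2) ^ 3) := by
    funext y
    ring
  rw [hfun]
  have hl := Real.hasDerivAt_log hx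
  have hd := (hasDerivAt_pow (n + 2) x).mul
    ((((hl.pow 2).div_const ((n : ℝ) + 2)).sub
      ((hl.const_mul 2).div_const (((n : ℝ) + 2) ^ 2))).add_const (2 / ((n : ℝ) + 2) ^ 3))
  refine hd.congr_deriv ?_
  have hn : (n : ℝ) + 2 ≠ 0 := by positivity
  simp only [Nat.add_succ_sub_one, Pi.sub_apply, Pi.pow_apply]
  push_cast
  field_simp
  ring

lemma integrableOn_pow_mul_log_sq (n : ℕ) :
    IntegrableOn (fun x : ℝ => x ^ (n + 1) * log x ^ 2) (Set.Ioo 0 1) := by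
  refine IntegrableOn.mono_set (intervalIntegral.integrableOn_deriv_of_nonneg
    (continuous_pow_mul_log_sq_primitive n).continuousOn
    (fun x hx => hasDerivAt_pow_mul_log_sq_primitive n hx.1.ne') ?_) Set.Ioo_subset_Ioc_self
  intro x hx
  have := hx.1
  positivity

lemma setIntegral_pow_mul_log_sq (n : ℕ) :
    ∫ x in Set.Ioo (0 : ℝ) 1, x ^ (n + 1) * log x ^ 2 = 2 / (n + 2) ^ 3 := by
  rw [← integral_Ioc_eq_integral_Ioo, ← intervalIntegral.integral_of_le zero_le_one,
    intervalIntegral.integral_eq_sub_of_hasDerivAt_of_le zero_le_one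
      (continuous_pow_mul_log_sq_primitive n).continuousOn
      (fun x hx => hasDerivAt_pow_mul_log_sq_primitive n hx.1.ne')]
  · simp
  · rw [intervalIntegrable_iff_integrableOn_Ioo_of_le zero_le_one]
    exact integrableOn_pow_mul_log_sq n

lemma integrableOn_prod_pow_mul_log_sq (n : ℕ) :
    IntegrableOn (fun p : ℝ × ℝ => (p.1 ^ (n + 1) * log p.1 ^ 2) * (p.2 ^ (n + 1) * log p.2 ^ 2))
      (Set.Ioo 0 1 ×ˢ Set.Ioo 0 1) := by
  rw [IntegrableOn, Measure.volume_eq_prod, ← Measure.prod_restrict]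
  exact (integrableOn_pow_mul_log_sq n).mul_prod (integrableOn_pow_mul_log_sq n)

lemma setIntegral_prod_pow_mul_log_sq (n : ℕ) :
    ∫ p in (Set.Ioo (0 : ℝ) 1) ×ˢ (Set.Ioo (0 : ℝ) 1),
      (p.1 ^ (n + 1) * log p.1 ^ 2) * (p.2 ^ (n + 1) * log p.2 ^ 2) = 4 / ((n : ℝ) + 2) ^ 6 := by
  rw [Measure.volume_eq_prod, setIntegral_prod_mul (fun x : ℝ => x ^ (n + 1) * log x ^ 2)
    (fun x : ℝ => x ^ (n + 1) * log x ^ 2), setIntegral_pow_mul_log_sq]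
  have hn : (n : ℝ) + 2 ≠ 0 := by positivity
  field_simp
  norm_num

lemma summable_one_div_succ_mul_pow_six {a : ℝ} (ha : 0 ≤ a) :
    Summable fun u : ℕ => 1 / (((u : ℝ) + 1) * (a + 2 * ((u : ℝ) + 1)) ^ 6) := by
  have h2 : Summable fun u : ℕ => 1 / ((u : ℝ) + 1) ^ 2 := by
    simpa using (summable_nat_add_iff 1).2 (Real.summable_one_div_nat_pow.2 one_lt_two)
  refine h2.of_nonneg_of_le (fun u => by positivity) fun u => ?_
  have hu : (0 : ℝ) ≤ u := u.cast_nonneg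
  have h1 : (u : ℝ) + 1 ≤ (a + 2 * ((u : ℝ) + 1)) ^ 6 :=
    le_trans (by linarith) (le_self_pow₀ (by linarith) (by norm_num))
  gcongr
  rw [sq]
  gcongr

theorem double_integral_series_two (k : ℕ) (hk : 1 ≤ k) :
    (∫ p in (Set.Ioo (0 : ℝ) 1) ×ˢ (Set.Ioo (0 : ℝ) 1),
        (Real.log p.1 / p.1) * (Real.log p.2 / p.2) * Real.log (1 - (p.1 * p.2) ^ 2) *
          Real.log p.1 * Real.log p.2 * (p.1 * p.2) ^ (2 * k + 1)) =
      -4 * ∑' u : ℕ, 1 / (((u : ℝ) + 1) * (2 * (k : ℝ) + 1 + 2 * ((u : ℝ) + 1)) ^ 6) := by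
  let F : ℕ → ℝ × ℝ → ℝ := fun u p => -1 / ((u : ℝ) + 1) *
    ((p.1 ^ (2 * k + 2 * u + 1 + 1) * log p.1 ^ 2) * (p.2 ^ (2 * k + 2 * u + 1 + 1) * log p.2 ^ 2))
  have hval : ∀ u : ℕ, -1 / ((u : ℝ) + 1) * (4 / (((2 * k + 2 * u + 1 : ℕ) : ℝ) + 2) ^ 6) =
      -4 * (1 / (((u : ℝ) + 1) * (2 * (k : ℝ) + 1 + 2 * ((u : ℝ) + 1)) ^ 6)) := by
    intro u
    push_cast
    rw [show 2 * (k : ℝ) + 2 * u + 1 + 2 = 2 * k + 1 + 2 * (u + 1) by ring]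
    field_simp
  have hint : ∀ u, ∫ p in (Set.Ioo (0 : ℝ) 1) ×ˢ (Set.Ioo (0 : ℝ) 1), F u p =
      -4 * (1 / (((u : ℝ) + 1) * (2 * (k : ℝ) + 1 + 2 * ((u : ℝ) + 1)) ^ 6)) := by
    intro u
    rw [integral_const_mul, setIntegral_prod_pow_mul_log_sq, hval]
  have hmeas : MeasurableSet ((Set.Ioo (0 : ℝ) 1) ×ˢ (Set.Ioo (0 : ℝ) 1)) :=
    measurableSet_Ioo.prod measurableSet_Ioo
  have hnorm : ∀ u, ∫ p in (Set.Ioo (0 : ℝ) 1) ×ˢ (Set.Ioo (0 : ℝ) 1), ‖F u p‖ =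
      4 * (1 / (((u : ℝ) + 1) * (2 * (k : ℝ) + 1 + 2 * ((u : ℝ) + 1)) ^ 6)) := by
    intro u
    rw [← neg_inj, ← integral_neg, ← neg_mul, ← hint u]
    refine setIntegral_congr_fun hmeas fun p hp => ?_
    have h1 := hp.1.1
    have h2 := hp.2.1
    have hneg : F u p ≤ 0 := mul_nonpos_of_nonpos_of_nonneg
      (div_nonpos_of_nonpos_of_nonneg (by norm_num) (by positivity)) (by positivity)
    simp only [Real.norm_of_nonpos hneg, neg_neg]
  have hsum := hasSum_integral_of_summable_integral_norm
    (μ := volume.restrict ((Set.Ioo (0 : ℝ) 1) ×ˢ (Set.Ioo (0 : ℝ) 1))) (F := F)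
    (fun u => (integrableOn_prod_pow_mul_log_sq _).const_mul _)
    (by
      simp only [hnorm]
      exact (summable_one_div_succ_mul_pow_six (by positivity)).mul_left 4)
  simp only [hint] at hsum
  rw [← tsum_mul_left, hsum.tsum_eq]
  refine setIntegral_congr_fun hmeas fun p hp => ?_
  obtain ⟨⟨hx0, hx1⟩, hy0, hy1⟩ := hp
  have hxy : |(p.1 * p.2) ^ 2| < 1 := by
    rw [abs_of_nonneg (by positivity)]
    exact pow_lt_one₀ (by positivity) (mul_lt_one_of_nonneg_of_lt_one_left hx0.le hx1 hy1.le)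
      two_ne_zero
  have hlog := (hasSum_pow_div_log_of_abs_lt_one hxy).mul_left
    (-(log p.1 ^ 2 * log p.2 ^ 2 * (p.1 * p.2) ^ (2 * k)))
  have hF : ∀ u : ℕ, -(log p.1 ^ 2 * log p.2 ^ 2 * (p.1 * p.2) ^ (2 * k)) *
      (((p.1 * p.2) ^ 2) ^ (u + 1) / ((u : ℝ) + 1)) = F u p := by
    intro u
    simp only [F]
    ring
  simp only [hF] at hlog
  rw [hlog.tsum_eq]
  field_simp
  ring
end

section
/- ζ(5) = − ∫_{(0,1)^2} (log(x)/x)·(log(y)/y)·log(1-xy) dx dy. -/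
open MeasureTheory Real

theorem intervalIntegrable_pow_mul_log (n : ℕ) (a b : ℝ) :
    IntervalIntegrable (fun x : ℝ => x ^ n * log x) volume a b :=
  intervalIntegral.intervalIntegrable_log'.continuousOn_mul (continuous_pow n).continuousOn

theorem integrableOn_pow_mul_log (n : ℕ) :
    IntegrableOn (fun x : ℝ => x ^ n * log x) (Set.Ioo 0 1) :=
  (intervalIntegrable_iff_integrableOn_Ioo_of_le zero_le_one).1
    (intervalIntegrable_pow_mul_log n 0 1)

theorem integral_pow_mul_log (n : ℕ) :
    ∫ x in Set.Ioo (0 : ℝ) 1, x ^ n * log x = -(1 / ((n : ℝ) + 1) ^ 2) := by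
  have hn : (n : ℝ) + 1 ≠ 0 := by positivity
  rw [← integral_Ioc_eq_integral_Ioo, ← intervalIntegral.integral_of_le zero_le_one]
  have hcont : Continuous fun x : ℝ =>
      x ^ n * (x * log x) / (n + 1) - x ^ (n + 1) / ((n : ℝ) + 1) ^ 2 := by
    have := continuous_mul_log
    fun_prop
  rw [intervalIntegral.integral_eq_sub_of_hasDerivAt_of_le zero_le_one hcont.continuousOn
    (fun x hx => ?_) (intervalIntegrable_pow_mul_log n 0 1)]
  · simp
  · have hx0 : x ≠ 0 := hx.1.ne'
    have h1 := (((hasDerivAt_pow (n + 1) x).mul (hasDerivAt_log hx0)).div_const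
      ((n : ℝ) + 1)).sub ((hasDerivAt_pow (n + 1) x).div_const (((n : ℝ) + 1) ^ 2))
    refine (h1.congr_of_eventuallyEq (.of_forall fun y => ?_)).congr_deriv ?_
    · change _ = y ^ (n + 1) * log y / ((n : ℝ) + 1) - y ^ (n + 1) / ((n : ℝ) + 1) ^ 2
      ring
    · simp only [Nat.add_sub_cancel, Nat.cast_add, Nat.cast_one]
      field_simp
      ring

theorem summable_one_div_nat_add_one_pow {s : ℕ} (hs : 1 < s) :
    Summable fun k : ℕ => 1 / ((k : ℝ) + 1) ^ s := by
  have h := (summable_nat_add_iff 1).2 (Real.summable_one_div_nat_pow.2 hs)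
  simpa using h

theorem hasSum_log_div_mul_log_one_sub_mul {x y : ℝ} (hx : x ∈ Set.Ioo (0 : ℝ) 1)
    (hy : y ∈ Set.Ioo (0 : ℝ) 1) :
    HasSum (fun n : ℕ => 1 / ((n : ℝ) + 1) * ((x ^ n * log x) * (y ^ n * log y)))
      (-(log x / x * (log y / y) * log (1 - x * y))) := by
  have hx0 : x ≠ 0 := hx.1.ne'
  have hy0 : y ≠ 0 := hy.1.ne'
  have hxy : |x * y| < 1 := by
    rw [abs_of_pos (mul_pos hx.1 hy.1)]
    exact mul_lt_one_of_nonneg_of_lt_one_left hx.1.le hx.2 hy.2.le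
  rw [← mul_neg]
  refine ((hasSum_pow_div_log_of_abs_lt_one hxy).mul_left (log x / x * (log y / y))).congr_fun
    fun n => ?_
  rw [mul_pow]
  field_simp
  ring

theorem zeta_five_double_integral :
    zetaVal 5 =
      -∫ p in (Set.Ioo (0 : ℝ) 1) ×ˢ (Set.Ioo (0 : ℝ) 1),
        (Real.log p.1 / p.1) * (Real.log p.2 / p.2) * Real.log (1 - p.1 * p.2) := by
  have hmeas : MeasurableSet (Set.Ioo (0 : ℝ) 1 ×ˢ Set.Ioo (0 : ℝ) 1) :=
    measurableSet_Ioo.prod measurableSet_Ioo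
  let F : ℕ → ℝ × ℝ → ℝ := fun n p =>
    1 / ((n : ℝ) + 1) * ((p.1 ^ n * log p.1) * (p.2 ^ n * log p.2))
  have hint (n : ℕ) :
      IntegrableOn (F n) (Set.Ioo (0 : ℝ) 1 ×ˢ Set.Ioo (0 : ℝ) 1) := by
    rw [IntegrableOn, Measure.volume_eq_prod, ← Measure.prod_restrict]
    exact ((integrableOn_pow_mul_log n).mul_prod (integrableOn_pow_mul_log n)).const_mul _
  have hval (n : ℕ) : ∫ p in Set.Ioo (0 : ℝ) 1 ×ˢ Set.Ioo (0 : ℝ) 1, F n p =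
      1 / ((n : ℝ) + 1) ^ 5 := by
    rw [integral_const_mul, Measure.volume_eq_prod,
      setIntegral_prod_mul (fun x : ℝ => x ^ n * log x) (fun y : ℝ => y ^ n * log y),
      integral_pow_mul_log]
    field_simp
  have hnorm (n : ℕ) : ∫ p in Set.Ioo (0 : ℝ) 1 ×ˢ Set.Ioo (0 : ℝ) 1, ‖F n p‖ =
      1 / ((n : ℝ) + 1) ^ 5 := by
    rw [← hval n]
    refine setIntegral_congr_fun hmeas fun p hp => norm_of_nonneg ?_
    obtain ⟨⟨hx0, hx1⟩, hy0, hy1⟩ := hp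
    exact mul_nonneg (by positivity) (mul_nonneg_of_nonpos_of_nonpos
      (mul_nonpos_of_nonneg_of_nonpos (by positivity) (log_nonpos hx0.le hx1.le))
      (mul_nonpos_of_nonneg_of_nonpos (by positivity) (log_nonpos hy0.le hy1.le)))
  have htsum := integral_tsum_of_summable_integral_norm hint (by
    simpa only [hnorm] using summable_one_div_nat_add_one_pow (s := 5) (by norm_num))
  simp only [hval] at htsum
  rw [zetaVal, htsum, ← integral_neg]
  exact setIntegral_congr_fun hmeas fun p hp =>
    (hasSum_log_div_mul_log_one_sub_mul hp.1 hp.2).tsum_eq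
end
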